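/- arXiv:1805.09853 — 2 statements merged into one kernel-verified Lean document; each statement's English description precedes it below -/
import Mathlib

section
/- Let G and H be graphs, and let A ⊆ V(G) and B ⊆ V(H) be nonempty subsets. Then A × B ∈ DP'(G □ H) if and only if A ∈ DP'(G) and B ∈ DP'(H). -/
open SimpleGraph

/-- The induced subgraph on `s` is an isometric subgraph of `G`:
distances within the induced subgraph agree with distances in `G`. -/
def IsIsometricSubset {V : Type*} (G : SimpleGraph V) (s : Set V) : Prop :=
  ∀ u v : s, (G.induce s).dist u v = G.dist u.1 v.1

/-- `A ∈ DP'(G)`: deleting the vertex set `A` from `G` leaves an isometric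
subgraph of `G`. -/
def MemDP' {V : Type*} (G : SimpleGraph V) (A : Set V) : Prop :=
  IsIsometricSubset G Aᶜ

theorem SimpleGraph.Walk.exists_walk_of_weakHom {V W : Type*} {G : SimpleGraph V}
    {H : SimpleGraph W} (f : V → W) (hf : ∀ u v, G.Adj u v → f u = f v ∨ H.Adj (f u) (f v))
    {u v : V} (p : G.Walk u v) :
    ∃ q : H.Walk (f u) (f v), q.length ≤ p.length ∧ ∀ y ∈ q.support, ∃ x ∈ p.support, f x = y := by
  induction p with
  | nil => exact ⟨.nil, le_rfl, by simp⟩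
  | @cons u w v h p ih =>
    obtain ⟨q, hq, hs⟩ := ih
    rcases hf u w h with he | ha
    · refine ⟨q.copy he.symm rfl, by simp; omega, fun y hy ↦ ?_⟩
      obtain ⟨x, hx, rfl⟩ := hs y (by simpa using hy)
      exact ⟨x, by simp [hx], rfl⟩
    · refine ⟨.cons ha q, by simpa using hq, fun y hy ↦ ?_⟩
      rw [Walk.support_cons, List.mem_cons] at hy
      rcases hy with rfl | hy
      · exact ⟨u, by simp, rfl⟩
      · obtain ⟨x, hx, rfl⟩ := hs y hy
        exact ⟨x, by simp [hx], rfl⟩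

theorem isIsometricSubset_iff_exists_walk {V : Type*} {G : SimpleGraph V} (hG : G.Connected)
    {s : Set V} : IsIsometricSubset G s ↔ ∀ u ∈ s, ∀ v ∈ s,
      ∃ p : G.Walk u v, p.length ≤ G.dist u v ∧ ∀ x ∈ p.support, x ∈ s := by
  constructor
  · intro h u hu v hv
    have hr : (G.induce s).Reachable ⟨u, hu⟩ ⟨v, hv⟩ := by
      by_cases huv : u = v
      · subst huv
        rfl
      · apply Reachable.of_dist_ne_zero
        rw [h]
        exact (hG.pos_dist_of_ne huv).ne'
    obtain ⟨p, hp⟩ := hr.exists_walk_length_eq_dist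
    obtain ⟨q, hq, hs⟩ := p.exists_walk_of_weakHom (H := G) Subtype.val fun _ _ ↦ .inr
    refine ⟨q, by rwa [hp, h] at hq, fun x hx ↦ ?_⟩
    obtain ⟨y, -, rfl⟩ := hs x hx
    exact y.2
  · intro h u v
    obtain ⟨p, hp, hs⟩ := h u u.2 v v.2
    apply le_antisymm
    · have hle := dist_le (p.induce s hs)
      have hlen : (p.induce s hs).length = p.length := by
        rw [← Walk.length_map (Embedding.induce s).toHom (p.induce s hs), Walk.map_induce]
        rfl
      exact (hle.trans_eq hlen).trans hp
    · obtain ⟨q, hq⟩ := (p.induce s hs).reachable.exists_walk_length_eq_dist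
      rw [← hq, ← Walk.length_map (Embedding.induce s).toHom q]
      exact dist_le _

theorem dist_boxProd_of_connected {V W : Type*} {G : SimpleGraph V} {H : SimpleGraph W}
    (hG : G.Connected) (hH : H.Connected) (x y : V × W) :
    (G □ H).dist x y = G.dist x.1 y.1 + H.dist x.2 y.2 := by
  have h := edist_boxProd (G := G) (H := H) x y
  rw [← ((hG.boxProd hH).preconnected x y).coe_dist_eq_edist,
    ← (hG.preconnected x.1 y.1).coe_dist_eq_edist,
    ← (hH.preconnected x.2 y.2).coe_dist_eq_edist] at h
  exact_mod_cast h

theorem SimpleGraph.Walk.dist_add_dist_le_length {V : Type*} {G : SimpleGraph V} {u v x : V}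
    (p : G.Walk u v) (hx : x ∈ p.support) : G.dist u x + G.dist x v ≤ p.length := by
  classical
  rw [← p.take_spec hx, Walk.length_append]
  exact add_le_add (dist_le _) (dist_le _)

theorem MemDP'.of_boxProd_left {V W : Type*} {G : SimpleGraph V} {H : SimpleGraph W}
    (hG : G.Connected) (hH : H.Connected) {A : Set V} {B : Set W} (hB : B.Nonempty)
    (h : MemDP' (G □ H) (A ×ˢ B)) : MemDP' G A := by
  obtain ⟨b, hb⟩ := hB
  refine (isIsometricSubset_iff_exists_walk hG).2 fun u hu v hv ↦ ?_
  obtain ⟨p, hp, hs⟩ := (isIsometricSubset_iff_exists_walk (hG.boxProd hH)).1 h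
    (u, b) (fun hx ↦ hu hx.1) (v, b) (fun hx ↦ hv hx.1)
  have hd := dist_boxProd_of_connected hG hH
  have hlen : p.length ≤ G.dist u v := by simpa [hd] using hp
  obtain ⟨q, hq, hqs⟩ := p.exists_walk_of_weakHom (H := G) Prod.fst (by
    intro x y hxy
    rcases boxProd_adj.1 hxy with hxy | hxy
    · exact .inr hxy.1
    · exact .inl hxy.2)
  refine ⟨q, hq.trans hlen, fun a ha haA ↦ ?_⟩
  obtain ⟨z, hz, rfl⟩ := hqs a ha
  have hz_le := p.dist_add_dist_le_length hz
  rw [hd, hd] at hz_le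
  have htri := hG.dist_triangle (u := u) (v := z.1) (w := v)
  have hzero : H.dist b z.2 = 0 := by
    dsimp only at hz_le
    omega
  have hbz : b = z.2 := hH.dist_eq_zero_iff.1 hzero
  exact hs z hz ⟨haA, hbz ▸ hb⟩

theorem MemDP'.of_boxProd_right {V W : Type*} {G : SimpleGraph V} {H : SimpleGraph W}
    (hG : G.Connected) (hH : H.Connected) {A : Set V} {B : Set W} (hA : A.Nonempty)
    (h : MemDP' (G □ H) (A ×ˢ B)) : MemDP' H B := by
  refine MemDP'.of_boxProd_left hH hG hA
    ((isIsometricSubset_iff_exists_walk (hH.boxProd hG)).2 fun x hx y hy ↦ ?_)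
  obtain ⟨p, hp, hs⟩ := (isIsometricSubset_iff_exists_walk (hG.boxProd hH)).1 h
    x.swap (fun hx' ↦ hx hx'.symm) y.swap (fun hy' ↦ hy hy'.symm)
  obtain ⟨q, hq, hqs⟩ := p.exists_walk_of_weakHom (H := H □ G) Prod.swap
    fun _ _ huv ↦ .inr (boxProd_adj.2 (boxProd_adj.1 huv).symm)
  refine ⟨q, hq.trans (hp.trans_eq ?_), fun z hz hzB ↦ ?_⟩
  · rw [dist_boxProd_of_connected hG hH, dist_boxProd_of_connected hH hG, add_comm]
    rfl
  · obtain ⟨w, hw, rfl⟩ := hqs z hz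
    exact hs w hw hzB.symm

theorem MemDP'.boxProd {V W : Type*} {G : SimpleGraph V} {H : SimpleGraph W}
    (hG : G.Connected) (hH : H.Connected) {A : Set V} {B : Set W}
    (hA : MemDP' G A) (hB : MemDP' H B) : MemDP' (G □ H) (A ×ˢ B) := by
  refine (isIsometricSubset_iff_exists_walk (hG.boxProd hH)).2 ?_
  rintro ⟨a, b⟩ hx ⟨a', b'⟩ hy
  rw [dist_boxProd_of_connected hG hH]
  have hleft (c : W) (p : G.Walk a a') :=
    p.exists_walk_of_weakHom (H := G □ H) (fun x ↦ (x, c))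
      fun _ _ h ↦ .inr (boxProd_adj_left.2 h)
  have hright (c : V) (q : H.Walk b b') :=
    q.exists_walk_of_weakHom (H := G □ H) (fun x ↦ (c, x))
      fun _ _ h ↦ .inr (boxProd_adj_right.2 h)
  have hpG : ∃ p : G.Walk a a', p.length ≤ G.dist a a' ∧
      (a ∉ A → a' ∉ A → ∀ x ∈ p.support, x ∉ A) := by
    by_cases h : a ∉ A ∧ a' ∉ A
    · obtain ⟨p, hp, hs⟩ := (isIsometricSubset_iff_exists_walk hG).1 hA a h.1 a' h.2
      exact ⟨p, hp, fun _ _ ↦ hs⟩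
    · obtain ⟨p, hp⟩ := hG.exists_walk_length_eq_dist a a'
      exact ⟨p, hp.le, fun h₁ h₂ ↦ (h ⟨h₁, h₂⟩).elim⟩
  have hqH : ∃ q : H.Walk b b', q.length ≤ H.dist b b' ∧
      (b ∉ B → b' ∉ B → ∀ x ∈ q.support, x ∉ B) := by
    by_cases h : b ∉ B ∧ b' ∉ B
    · obtain ⟨q, hq, hs⟩ := (isIsometricSubset_iff_exists_walk hH).1 hB b h.1 b' h.2
      exact ⟨q, hq, fun _ _ ↦ hs⟩
    · obtain ⟨q, hq⟩ := hH.exists_walk_length_eq_dist b b'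
      exact ⟨q, hq.le, fun h₁ h₂ ↦ (h ⟨h₁, h₂⟩).elim⟩
  obtain ⟨p, hp, hpA⟩ := hpG
  obtain ⟨q, hq, hqB⟩ := hqH
  simp only [Set.mem_compl_iff, Set.mem_prod] at hx hy ⊢
  by_cases h : a' ∈ A ∧ b ∈ B
  · obtain ⟨r₁, h₁, hr₁⟩ := hright a q
    obtain ⟨r₂, h₂, hr₂⟩ := hleft b' p
    refine ⟨r₁.append r₂, ?_, fun z hz ↦ ?_⟩
    · rw [Walk.length_append]
      omega
    · rcases (Walk.mem_support_append_iff _ _).1 hz with hz | hz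
      · obtain ⟨x, hx, rfl⟩ := hr₁ z hz
        grind
      · obtain ⟨x, hx, rfl⟩ := hr₂ z hz
        grind
  · obtain ⟨r₁, h₁, hr₁⟩ := hleft b p
    obtain ⟨r₂, h₂, hr₂⟩ := hright a' q
    refine ⟨r₁.append r₂, ?_, fun z hz ↦ ?_⟩
    · rw [Walk.length_append]
      omega
    · rcases (Walk.mem_support_append_iff _ _).1 hz with hz | hz
      · obtain ⟨x, hx, rfl⟩ := hr₁ z hz
        grind
      · obtain ⟨x, hx, rfl⟩ := hr₂ z hz
        grind

/-- For connected graphs `G`, `H` and nonempty vertex subsets `A ⊆ V(G)`,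
`B ⊆ V(H)`: `A × B ∈ DP'(G □ H)` iff `A ∈ DP'(G)` and `B ∈ DP'(H)`. -/
theorem boxProd_memDP'_iff {V W : Type*} [Fintype V] [Fintype W]
    (G : SimpleGraph V) (H : SimpleGraph W)
    (hG : G.Connected) (hH : H.Connected)
    (A : Set V) (B : Set W) (hA : A.Nonempty) (hB : B.Nonempty) :
    MemDP' (G □ H) (A ×ˢ B) ↔ MemDP' G A ∧ MemDP' H B := by
  exact ⟨fun h ↦ ⟨h.of_boxProd_left hG hH hB, h.of_boxProd_right hG hH hA⟩,
    fun h ↦ h.1.boxProd hG hH h.2⟩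
end

section
/- If G is a sequentially distance preserving graph and H is a distance preserving graph, then the Cartesian product G □ H is distance preserving. -/
open SimpleGraph

/-- A graph is distance preserving (dp) if it has an isometric subgraph with `k`
vertices for every `1 ≤ k ≤ |V(G)|`. -/
def IsDP {V : Type*} [Fintype V] (G : SimpleGraph V) : Prop :=
  ∀ k : ℕ, 1 ≤ k → k ≤ Fintype.card V →
    ∃ s : Set V, IsIsometricSubset G s ∧ s.ncard = k

/-- A graph is sequentially distance preserving (sdp) if its vertices can be
ordered `v₁, …, vₙ` so that for every `i`, deleting the first `i` vertices
leaves an isometric subgraph. -/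
def IsSDP {V : Type*} [Fintype V] (G : SimpleGraph V) : Prop :=
  ∃ f : Fin (Fintype.card V) ≃ V, ∀ i : ℕ,
    IsIsometricSubset G (f '' {j : Fin (Fintype.card V) | i ≤ (j : ℕ)})

/-- Every pair of distinct vertices of an isometric subset is joined by a geodesic whose first step
stays in the subset. -/
theorem IsIsometricSubset.exists_adj {V : Type*} {G : SimpleGraph V} (hG : G.Connected)
    {s : Set V} (hs : IsIsometricSubset G s) {u v : V} (hu : u ∈ s) (hv : v ∈ s) (huv : u ≠ v) :
    ∃ w ∈ s, G.Adj u w ∧ G.dist w v + 1 = G.dist u v := by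
  have h : (G.induce s).dist ⟨u, hu⟩ ⟨v, hv⟩ = G.dist u v := hs ⟨u, hu⟩ ⟨v, hv⟩
  have hpos : 0 < G.dist u v := hG.pos_dist_of_ne huv
  have hr : (G.induce s).Reachable ⟨u, hu⟩ ⟨v, hv⟩ :=
    Reachable.of_dist_ne_zero (by rw [h]; exact hpos.ne')
  obtain ⟨p, hp⟩ := hr.exists_walk_length_eq_dist
  cases p with
  | nil => exact absurd rfl huv
  | @cons _ w _ hadj q =>
    refine ⟨w, w.2, hadj, ?_⟩
    have h₁ := dist_le q
    rw [hs w ⟨v, hv⟩] at h₁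
    have h₂ : G.Adj u w := hadj
    have h₃ := hG.dist_triangle (u := u) (v := w) (w := v)
    rw [dist_eq_one_iff_adj.mpr h₂] at h₃
    rw [h, Walk.length_cons] at hp
    simp only at h₁
    omega

/-- A subset in which every pair of distinct vertices admits a distance-decreasing step is
isometric. -/
theorem isIsometricSubset_of_exists_adj {V : Type*} {G : SimpleGraph V} (hG : G.Connected)
    {s : Set V} (hs : ∀ u ∈ s, ∀ v ∈ s, u ≠ v →
      ∃ w ∈ s, G.Adj u w ∧ G.dist w v + 1 = G.dist u v) :
    IsIsometricSubset G s := by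
  have key : ∀ (n : ℕ) (u v : s), G.dist u.1 v.1 = n →
      ∃ p : (G.induce s).Walk u v, p.length = n := by
    intro n
    induction n with
    | zero =>
      intro u v h
      obtain rfl : u = v := Subtype.ext (hG.dist_eq_zero_iff.mp h)
      exact ⟨.nil, rfl⟩
    | succ n ih =>
      intro u v h
      have hne : u.1 ≠ v.1 := fun he => by simp [he] at h
      obtain ⟨w, hw, hadj, hd⟩ := hs u u.2 v v.2 hne
      obtain ⟨p, hp⟩ := ih ⟨w, hw⟩ v (by simp only; omega)
      have hadj' : (G.induce s).Adj u ⟨w, hw⟩ := hadj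
      exact ⟨.cons hadj' p, by simp [hp]⟩
  intro u v
  obtain ⟨p, hp⟩ := key _ u v rfl
  refine le_antisymm (hp ▸ dist_le p) ?_
  obtain ⟨q, hq⟩ := p.reachable.exists_walk_length_eq_dist
  rw [← hq, ← Walk.length_map (Embedding.induce s).toHom q]
  exact dist_le _

theorem isIsometricSubset_univ {V : Type*} {G : SimpleGraph V} (hG : G.Connected) :
    IsIsometricSubset G Set.univ := by
  refine isIsometricSubset_of_exists_adj hG fun u _ v _ huv => ?_
  obtain ⟨p, hp⟩ := hG.exists_walk_length_eq_dist u v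
  cases p with
  | nil => exact absurd rfl huv
  | @cons _ w _ hadj q =>
    refine ⟨w, trivial, hadj, ?_⟩
    have h₁ := dist_le q
    have h₃ := hG.dist_triangle (u := u) (v := w) (w := v)
    rw [dist_eq_one_iff_adj.mpr hadj] at h₃
    rw [Walk.length_cons] at hp
    omega

/-- Attaching a copy of an isometric subset in a new fibre to a full box product over an isometric
subset yields an isometric subset. -/
theorem IsIsometricSubset.boxProd_union {V W : Type*} {G : SimpleGraph V} {H : SimpleGraph W}
    (hG : G.Connected) (hH : H.Connected) {A : Set V} {B : Set W} {x : V}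
    (hA : IsIsometricSubset G A) (hxA : IsIsometricSubset G (insert x A))
    (hB : IsIsometricSubset H B) :
    IsIsometricSubset (G □ H) (A ×ˢ Set.univ ∪ {x} ×ˢ B) := by
  have hd : ∀ a b : V × W, (G □ H).dist a b = G.dist a.1 b.1 + H.dist a.2 b.2 := fun a b => by
    have h := edist_boxProd (G := G) (H := H) a b
    rw [← ((hG.boxProd hH).preconnected a b).coe_dist_eq_edist,
      ← (hG.preconnected a.1 b.1).coe_dist_eq_edist,
      ← (hH.preconnected a.2 b.2).coe_dist_eq_edist] at h
    exact_mod_cast h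
  have left : ∀ {s : Set V} {u u' : V} {w w' : W}, IsIsometricSubset G s → u ∈ s → u' ∈ s →
      u ≠ u' → ∃ u₁ ∈ s, G.Adj u u₁ ∧ (G □ H).Adj (u, w) (u₁, w) ∧
        (G □ H).dist (u₁, w) (u', w') + 1 = (G □ H).dist (u, w) (u', w') := by
    intro s u u' w w' hs hu hu' hne
    obtain ⟨u₁, h₁, hadj, h⟩ := hs.exists_adj hG hu hu' hne
    refine ⟨u₁, h₁, hadj, by simp [boxProd_adj, hadj], ?_⟩
    simp only [hd]
    omega
  have right : ∀ {s : Set W} {u u' : V} {w w' : W}, IsIsometricSubset H s → w ∈ s → w' ∈ s →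
      w ≠ w' → ∃ w₁ ∈ s, (G □ H).Adj (u, w) (u, w₁) ∧
        (G □ H).dist (u, w₁) (u', w') + 1 = (G □ H).dist (u, w) (u', w') := by
    intro s u u' w w' hs hw hw' hne
    obtain ⟨w₁, h₁, hadj, h⟩ := hs.exists_adj hH hw hw' hne
    refine ⟨w₁, h₁, by simp [boxProd_adj, hadj], ?_⟩
    simp only [hd]
    omega
  have hU := isIsometricSubset_univ hH
  refine isIsometricSubset_of_exists_adj (hG.boxProd hH) ?_
  rintro ⟨u, w⟩ hu ⟨u', w'⟩ hu' hne
  simp only [Set.mem_union, Set.mem_prod, Set.mem_univ, and_true, Set.mem_singleton_iff]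
    at hu hu'
  by_cases huA : u ∈ A
  · by_cases hw : w = w'
    · subst hw
      have huu : u ≠ u' := fun h => hne (by rw [h])
      rcases hu' with hu' | ⟨rfl, hwB⟩
      · obtain ⟨u₁, h₁, -, h⟩ := left (w := w) (w' := w) hA huA hu' huu
        exact ⟨(u₁, w), Or.inl ⟨h₁, trivial⟩, h⟩
      · obtain ⟨u₁, h₁, -, h⟩ := left (w := w) (w' := w) hxA (Or.inr huA) (Or.inl rfl) huu
        refine ⟨(u₁, w), ?_, h⟩
        rcases h₁ with rfl | h₁
        · exact Or.inr ⟨rfl, hwB⟩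
        · exact Or.inl ⟨h₁, trivial⟩
    · obtain ⟨w₁, -, h⟩ := right (u := u) (u' := u') hU trivial trivial hw
      exact ⟨(u, w₁), Or.inl ⟨huA, trivial⟩, h⟩
  · obtain ⟨rfl, hwB⟩ := hu.resolve_left huA
    by_cases huu : u = u'
    · subst huu
      obtain ⟨-, hwB'⟩ := hu'.resolve_left huA
      obtain ⟨w₁, h₁, h⟩ := right (u := u) (u' := u) hB hwB hwB' fun h => hne (by rw [h])
      exact ⟨(u, w₁), Or.inr ⟨rfl, h₁⟩, h⟩
    · have hu'A : u' ∈ A := hu'.resolve_right fun h => huu h.1.symm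
      obtain ⟨u₁, h₁, hadj, h⟩ := left (w := w) (w' := w') hxA (Or.inl rfl) (Or.inr hu'A) huu
      exact ⟨(u₁, w), Or.inl ⟨h₁.resolve_left hadj.ne', trivial⟩, h⟩

/-- If `G` is sequentially distance preserving and `H` is distance preserving
(both connected), then the Cartesian product `G □ H` is distance preserving. -/
theorem boxProd_dp_of_sdp_dp {V W : Type*} [Fintype V] [Fintype W]
    (G : SimpleGraph V) (H : SimpleGraph W)
    (hG : G.Connected) (hH : H.Connected)
    (hsdp : IsSDP G) (hdp : IsDP H) :
    IsDP (G □ H) := by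
  obtain ⟨f, hf⟩ := hsdp
  intro k hk1 hk
  rw [Fintype.card_prod] at hk
  have := hH.nonempty
  have hm : 0 < Fintype.card W := Fintype.card_pos
  obtain ⟨q, r, hq, hr, rfl⟩ : ∃ q r, q < Fintype.card V ∧ r < Fintype.card W ∧
      Fintype.card W * q + (r + 1) = k := by
    refine ⟨(k - 1) / Fintype.card W, (k - 1) % Fintype.card W,
      (Nat.div_lt_iff_lt_mul hm).mpr (by omega), Nat.mod_lt _ hm, ?_⟩
    have := Nat.div_add_mod (k - 1) (Fintype.card W)
    omega
  obtain ⟨B, hB, hBr⟩ := hdp (r + 1) (by omega) hr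
  let i : Fin (Fintype.card V) := ⟨Fintype.card V - 1 - q, by omega⟩
  have hins : insert (f i) (f '' {j | Fintype.card V - q ≤ (j : ℕ)}) = f '' {j | Fintype.card V - 1 - q ≤ (j : ℕ)} := by
    rw [← Set.image_insert_eq]
    congr 1
    ext j
    simp only [Set.mem_insert_iff, Set.mem_ofPred_eq, Fin.ext_iff, i]
    omega
  have hcard : (f '' {j | Fintype.card V - q ≤ (j : ℕ)}).ncard = q := by
    rw [Set.ncard_image_of_injective _ f.injective, ← Nat.card_coe_set_eq, Nat.card_eq_fintype_card,
      Fintype.card_subtype]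
    have h := Fin.card_filter_val_lt (n := Fintype.card V) (m := Fintype.card V - q)
    have h' := Finset.card_filter_add_card_filter_not (s := (Finset.univ : Finset (Fin (Fintype.card V))))
      (fun j => (j : ℕ) < Fintype.card V - q)
    simp only [not_lt, Finset.card_univ, Fintype.card_fin] at h'
    simp only [Set.mem_ofPred_eq]
    omega
  refine ⟨_, (hf (Fintype.card V - q)).boxProd_union hG hH (hins ▸ hf (Fintype.card V - 1 - q)) hB, ?_⟩
  rw [Set.ncard_union_eq, Set.ncard_prod, Set.ncard_prod, hcard, hBr, Set.ncard_univ,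
    Set.ncard_singleton, Nat.card_eq_fintype_card]
  · ring
  · refine Set.disjoint_left.mpr ?_
    rintro ⟨a, b⟩ ⟨⟨j, hj, hja⟩, -⟩ ⟨ha, -⟩
    obtain rfl : j = i := f.injective (hja.trans ha)
    simp only [Set.mem_ofPred_eq, i] at hj
    omega
end
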